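/- Two finite connected graphs Γ and Γ' are equivalent (i.e. the topological realizations |C(Γ)| and |C(Γ')| of their cores are homeomorphic) if and only if there exist two finite sequences of elementary modifications Γ = Γ_0 → Γ_1 → … → Γ_n and Γ' = Γ'_0 → Γ'_1 → … → Γ'_m such that the graphs Γ_n and Γ'_m are isomorphic. -/

import Mathlib

/-! Graphs in the sense of Serre, their topological realizations, and cores. -/

/-- A graph: vertices, edges, a fixed-point-free involution `e ↦ ē` (reversal),
and an endpoint map `e ↦ ι e`. -/
structure SerreGraph where
  V : Type
  E : Type
  bar : E → E
  bar_ne : ∀ e, bar e ≠ e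
  bar_bar : ∀ e, bar (bar e) = e
  ι : E → V

namespace SerreGraph

variable (Γ : SerreGraph)

instance : TopologicalSpace Γ.V := ⊥
instance : TopologicalSpace Γ.E := ⊥

/-- `IsWalk l u v`: the list of edges `l` is a path (walk) joining `u` to `v`. -/
def IsWalk : List Γ.E → Γ.V → Γ.V → Prop
  | [], u, v => u = v
  | e :: l, u, v => Γ.ι e = u ∧ IsWalk l (Γ.ι (Γ.bar e)) v

/-- A walk is *reduced* if no edge is immediately followed by its reverse. -/
def IsReduced (l : List Γ.E) : Prop := l.Chain' fun e e' => e' ≠ Γ.bar e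

/-- A graph is connected if any two vertices can be joined by a path. -/
def Connected : Prop := ∀ u v : Γ.V, ∃ l : List Γ.E, Γ.IsWalk l u v

/-- A graph is a tree if any two vertices are joined by a unique reduced path. -/
def IsGraphTree : Prop :=
  ∀ u v : Γ.V, ∃! l : List Γ.E, Γ.IsWalk l u v ∧ Γ.IsReduced l

/-- The generating relation of the topological realization: `(e,0) ∼ ι e` and
`(e,t) ∼ (ē, 1 - t)`. -/
inductive RealRel : (Γ.V ⊕ Γ.E × unitInterval) → (Γ.V ⊕ Γ.E × unitInterval) → Prop
  | endpoint (e : Γ.E) : RealRel (Sum.inr (e, 0)) (Sum.inl (Γ.ι e))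
  | flip (e : Γ.E) (t : unitInterval) :
      RealRel (Sum.inr (e, t)) (Sum.inr (Γ.bar e, unitInterval.symm t))

/-- The topological realization `|Γ|` of the graph `Γ`: the quotient of
`V(Γ) ⊔ (E(Γ) × [0,1])` under the identifications `(e,0) ∼ ι e`, `(e,t) ∼ (ē,1-t)`,
with the quotient topology (vertices and edges being discrete). -/
def Realization : Type := Quot Γ.RealRel

instance : TopologicalSpace Γ.Realization :=
  instTopologicalSpaceQuot

/-- The point of `|Γ|` corresponding to a vertex. -/
def vertexPoint (v : Γ.V) : Γ.Realization := Quot.mk _ (Sum.inl v)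

/-- The point of `|Γ|` corresponding to a parameter `t` on an edge `e`. -/
def edgePoint (e : Γ.E) (t : unitInterval) : Γ.Realization := Quot.mk _ (Sum.inr (e, t))

/-- The set of edges of the *core* `C(Γ)` of `Γ`: for a finite connected graph,
repeatedly deleting a vertex of degree one together with its incident edge pair
terminates in the largest subgraph all of whose vertices have degree at least two
(the empty subgraph iff `Γ` is a tree).  An edge is in the core iff it belongs to
some subgraph (a set of edges closed under reversal) in which every vertex met has
degree at least two. -/
def coreEdges : Set Γ.E :=
  {e | ∃ S : Set Γ.E, e ∈ S ∧ (∀ a ∈ S, Γ.bar a ∈ S) ∧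
    ∀ a ∈ S, ∃ b ∈ S, b ≠ a ∧ Γ.ι b = Γ.ι a}

/-- The topological realization `|C(Γ)|` of the core of `Γ`, as a subspace of `|Γ|`
(empty iff `Γ` is a tree, matching the convention `|∅| = ∅`). -/
def coreRealization : Set Γ.Realization :=
  {p | ∃ e ∈ Γ.coreEdges, ∃ t : unitInterval, p = Γ.edgePoint e t}

end SerreGraph

namespace SerreGraph

/-- An isomorphism of graphs. -/
structure Iso (Γ Γ' : SerreGraph) where
  vEquiv : Γ.V ≃ Γ'.V
  eEquiv : Γ.E ≃ Γ'.E
  map_bar : ∀ e, eEquiv (Γ.bar e) = Γ'.bar (eEquiv e)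
  map_ι : ∀ e, vEquiv (Γ.ι e) = Γ'.ι (eEquiv e)

/-- Expansion of `Γ` at a vertex `u`: add a new vertex (`none`) and a new edge pair
joining `u` to it. -/
def expand (Γ : SerreGraph) (u : Γ.V) : SerreGraph where
  V := Option Γ.V
  E := Γ.E ⊕ Bool
  bar := Sum.elim (fun e => Sum.inl (Γ.bar e)) (fun b => Sum.inr !b)
  bar_ne := by
    rintro (e | b)
    · simpa using Γ.bar_ne e
    · simp
  bar_bar := by
    rintro (e | b)
    · simpa using Γ.bar_bar e
    · simp
  ι := Sum.elim (fun e => some (Γ.ι e)) (fun b => if b then some u else none)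

/-- Subdivision of `Γ` at an edge `e₀`: delete `e₀` and its reverse, add a new vertex
(`none`) and two new edge pairs joining `ι e₀` to the new vertex and the new vertex to
`ι ē₀`. -/
def subdivide (Γ : SerreGraph) (e₀ : Γ.E) : SerreGraph where
  V := Option Γ.V
  E := {e : Γ.E // e ≠ e₀ ∧ e ≠ Γ.bar e₀} ⊕ Bool × Bool
  bar := Sum.elim
    (fun e => Sum.inl ⟨Γ.bar e.1, by
      refine ⟨fun h => e.2.2 ?_, fun h => e.2.1 ?_⟩
      · have := congrArg Γ.bar h; rwa [Γ.bar_bar] at this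
      · have := congrArg Γ.bar h; rwa [Γ.bar_bar, Γ.bar_bar] at this⟩)
    (fun p => Sum.inr (p.1, !p.2))
  bar_ne := by
    rintro (e | p)
    · simpa [Subtype.ext_iff] using Γ.bar_ne e.1
    · simp [Prod.ext_iff]
  bar_bar := by
    rintro (e | p)
    · simp [Subtype.ext_iff, Γ.bar_bar]
    · simp
  ι := Sum.elim (fun e => some (Γ.ι e.1))
    (fun p =>
      match p with
      | (false, false) => some (Γ.ι e₀)
      | (false, true) => none
      | (true, false) => none
      | (true, true) => some (Γ.ι (Γ.bar e₀)))

/-- An elementary modification of graphs: an expansion at a vertex, a subdivision of an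
edge, or an isomorphism of graphs. -/
def ElemMod (Γ Δ : SerreGraph) : Prop :=
  (∃ u : Γ.V, Nonempty (Iso (Γ.expand u) Δ)) ∨
    (∃ e : Γ.E, Nonempty (Iso (Γ.subdivide e) Δ)) ∨ Nonempty (Iso Γ Δ)

end SerreGraph

namespace SerreGraph

/-! ### Isomorphisms and commutation of elementary modifications -/

namespace Iso

/-- The identity isomorphism. -/
protected def refl (Γ : SerreGraph) : Iso Γ Γ :=
  ⟨Equiv.refl _, Equiv.refl _, fun _ => rfl, fun _ => rfl⟩

variable {Γ Δ Θ : SerreGraph}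

/-- The inverse of an isomorphism. -/
protected def symm (f : Iso Γ Δ) : Iso Δ Γ where
  vEquiv := f.vEquiv.symm
  eEquiv := f.eEquiv.symm
  map_bar e := by rw [Equiv.symm_apply_eq, f.map_bar, Equiv.apply_symm_apply]
  map_ι e := by rw [Equiv.symm_apply_eq, f.map_ι, Equiv.apply_symm_apply]

/-- The composition of two isomorphisms. -/
protected def trans (f : Iso Γ Δ) (g : Iso Δ Θ) : Iso Γ Θ where
  vEquiv := f.vEquiv.trans g.vEquiv
  eEquiv := f.eEquiv.trans g.eEquiv
  map_bar e := by simp [f.map_bar, g.map_bar]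
  map_ι e := by simp [f.map_ι, g.map_ι]

/-- Expansions are compatible with isomorphisms. -/
def expandCongr (f : Iso Γ Δ) (u : Γ.V) : Iso (Γ.expand u) (Δ.expand (f.vEquiv u)) where
  vEquiv := Equiv.optionCongr f.vEquiv
  eEquiv := Equiv.sumCongr f.eEquiv (Equiv.refl Bool)
  map_bar := by
    rintro (e | b)
    · exact congrArg Sum.inl (f.map_bar e)
    · rfl
  map_ι := by
    rintro (e | _ | _)
    · exact congrArg some (f.map_ι e)
    · rfl
    · rfl

/-- Subdivisions are compatible with isomorphisms. -/
def subdivideCongr (f : Iso Γ Δ) (e₀ : Γ.E) :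
    Iso (Γ.subdivide e₀) (Δ.subdivide (f.eEquiv e₀)) where
  vEquiv := Equiv.optionCongr f.vEquiv
  eEquiv := Equiv.sumCongr
    (f.eEquiv.subtypeEquiv fun e => by simp [← f.map_bar]) (Equiv.refl (Bool × Bool))
  map_bar := by
    rintro (e | p)
    · exact congrArg Sum.inl (Subtype.ext (f.map_bar e.1))
    · rfl
  map_ι := by
    rintro (e | ⟨_ | _, _ | _⟩)
    · exact congrArg some (f.map_ι e.1)
    · exact congrArg some (f.map_ι e₀)
    · rfl
    · rfl
    · exact congrArg some ((f.map_ι _).trans (congrArg Δ.ι (f.map_bar e₀)))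

/-- Exchange of the two outer points of `Option (Option α)`. -/
def optionSwap (α : Type) : Option (Option α) ≃ Option (Option α) where
  toFun
    | none => some none
    | some none => none
    | some (some a) => some (some a)
  invFun
    | none => some none
    | some none => none
    | some (some a) => some (some a)
  left_inv := by rintro (_ | _ | a) <;> rfl
  right_inv := by rintro (_ | _ | a) <;> rfl

/-- Two expansions commute. -/
def expandComm (Γ : SerreGraph) (u w : Γ.V) :
    Iso ((Γ.expand u).expand (some w)) ((Γ.expand w).expand (some u)) where
  vEquiv := optionSwap Γ.V
  eEquiv :=
    { toFun := Sum.elim (Sum.elim (fun e => Sum.inl (Sum.inl e)) Sum.inr)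
        (fun b => Sum.inl (Sum.inr b))
      invFun := Sum.elim (Sum.elim (fun e => Sum.inl (Sum.inl e)) Sum.inr)
        (fun b => Sum.inl (Sum.inr b))
      left_inv := by rintro ((e | b) | b) <;> rfl
      right_inv := by rintro ((e | b) | b) <;> rfl }
  map_bar := by rintro ((e | b) | b) <;> rfl
  map_ι := by rintro ((e | _ | _) | _ | _) <;> rfl

/-- Expansions and subdivisions commute. -/
def subdivideExpandComm (Γ : SerreGraph) (u : Γ.V) (e₀ : Γ.E) :
    Iso ((Γ.subdivide e₀).expand (some u)) ((Γ.expand u).subdivide (Sum.inl e₀)) where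
  vEquiv := optionSwap Γ.V
  eEquiv :=
    { toFun
        | Sum.inl (Sum.inl e) => Sum.inl ⟨Sum.inl e.1,
            fun h => e.2.1 (Sum.inl_injective h), fun h => e.2.2 (Sum.inl_injective h)⟩
        | Sum.inl (Sum.inr p) => Sum.inr p
        | Sum.inr b => Sum.inl ⟨Sum.inr b, Sum.inr_ne_inl, Sum.inr_ne_inl⟩
      invFun
        | Sum.inl ⟨Sum.inl e, h⟩ => Sum.inl (Sum.inl ⟨e,
            fun h' => h.1 (congrArg Sum.inl h'), fun h' => h.2 (congrArg Sum.inl h')⟩)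
        | Sum.inl ⟨Sum.inr b, _⟩ => Sum.inr b
        | Sum.inr p => Sum.inl (Sum.inr p)
      left_inv := by rintro ((e | p) | b) <;> rfl
      right_inv := by rintro (⟨e | b, h⟩ | p) <;> rfl }
  map_bar := by rintro ((e | p) | b) <;> rfl
  map_ι := by rintro ((e | ⟨_ | _, _ | _⟩) | _ | _) <;> rfl

end Iso

/-- A step which is an expansion or an isomorphism. -/
def ExpandStep (Γ Δ : SerreGraph) : Prop :=
  (∃ u : Γ.V, Nonempty (Iso (Γ.expand u) Δ)) ∨ Nonempty (Iso Γ Δ)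

/-- A step which is a subdivision. -/
def SubdivideStep (Γ Δ : SerreGraph) : Prop :=
  ∃ e : Γ.E, Nonempty (Iso (Γ.subdivide e) Δ)

theorem expandStep_le_elemMod : ExpandStep ≤ ElemMod :=
  fun _ _ h => h.elim Or.inl fun h => Or.inr (Or.inr h)

theorem subdivideStep_le_elemMod : SubdivideStep ≤ ElemMod :=
  fun _ _ h => Or.inr (Or.inl h)

theorem ExpandStep.diamond {Γ Δ Θ : SerreGraph} (h : ExpandStep Γ Δ) (h' : ExpandStep Γ Θ) :
    ∃ Λ, ExpandStep Δ Λ ∧ ExpandStep Θ Λ := by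
  rcases h with ⟨u, ⟨f⟩⟩ | ⟨⟨f⟩⟩ <;> rcases h' with ⟨w, ⟨g⟩⟩ | ⟨⟨g⟩⟩
  · exact ⟨(Γ.expand u).expand (some w), Or.inl ⟨_, ⟨(f.expandCongr (some w)).symm⟩⟩,
      Or.inl ⟨_, ⟨(g.expandCongr (some u)).symm.trans (Iso.expandComm Γ w u)⟩⟩⟩
  · exact ⟨Δ, Or.inr ⟨Iso.refl _⟩, Or.inl ⟨_, ⟨(g.expandCongr u).symm.trans f⟩⟩⟩
  · exact ⟨Θ, Or.inl ⟨_, ⟨(f.expandCongr w).symm.trans g⟩⟩, Or.inr ⟨Iso.refl _⟩⟩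
  · exact ⟨Γ, Or.inr ⟨f.symm⟩, Or.inr ⟨g.symm⟩⟩

theorem ExpandStep.commute {Γ Δ Θ : SerreGraph} (h : ExpandStep Γ Δ) (h' : SubdivideStep Γ Θ) :
    ∃ Λ, SubdivideStep Δ Λ ∧ ExpandStep Θ Λ := by
  obtain ⟨e, ⟨g⟩⟩ := h'
  rcases h with ⟨u, ⟨f⟩⟩ | ⟨⟨f⟩⟩
  · exact ⟨(Γ.expand u).subdivide (Sum.inl e), ⟨_, ⟨(f.subdivideCongr (Sum.inl e)).symm⟩⟩,
      Or.inl ⟨_, ⟨(g.expandCongr (some u)).symm.trans (Iso.subdivideExpandComm Γ u e)⟩⟩⟩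
  · exact ⟨Θ, ⟨_, ⟨(f.subdivideCongr e).symm.trans g⟩⟩, Or.inr ⟨Iso.refl _⟩⟩

open Relation in
/-- Two commuting relations have commuting reflexive transitive closures. -/
theorem reflTransGen_commute {α : Type*} {r s : α → α → Prop}
    (h : ∀ a b c, r a b → s a c → ∃ d, s b d ∧ r c d) {a b c : α}
    (hr : ReflTransGen r a b) (hs : ReflTransGen s a c) :
    ∃ d, ReflTransGen s b d ∧ ReflTransGen r c d := by
  have strip : ∀ {a b c : α}, r a b → ReflTransGen s a c → ∃ d, ReflTransGen s b d ∧ r c d := by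
    intro a b c hr hs
    induction hs with
    | refl => exact ⟨b, .refl, hr⟩
    | tail _ hs ih =>
      obtain ⟨d, hd, hd'⟩ := ih
      obtain ⟨d', h1, h2⟩ := h _ _ _ hd' hs
      exact ⟨d', hd.tail h1, h2⟩
  induction hr with
  | refl => exact ⟨c, hs, .refl⟩
  | tail _ hr ih =>
    obtain ⟨d, hd, hd'⟩ := ih
    obtain ⟨d', h1, h2⟩ := strip hr hd
    exact ⟨d', h1, hd'.tail h2⟩

open Relation in
/-- If `Γ` and `Γ'` arise by expansions from graphs with isomorphic subdivisions, then
they have a common modification. -/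
theorem exists_common_modification {Γ Γ' Γ₀ Γ₀' Δ Δ' : SerreGraph}
    (hΓ : ReflTransGen ExpandStep Γ₀ Γ) (hΓ' : ReflTransGen ExpandStep Γ₀' Γ')
    (hΔ : ReflTransGen SubdivideStep Γ₀ Δ) (hΔ' : ReflTransGen SubdivideStep Γ₀' Δ')
    (f : Iso Δ Δ') :
    ∃ Λ, ReflTransGen ElemMod Γ Λ ∧ ReflTransGen ElemMod Γ' Λ := by
  obtain ⟨D, hD, hD₁⟩ := reflTransGen_commute (fun _ _ _ => ExpandStep.commute) hΓ hΔ
  obtain ⟨D', hD', hD₁'⟩ := reflTransGen_commute (fun _ _ _ => ExpandStep.commute) hΓ' hΔ'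
  obtain ⟨Λ, hΛ, hΛ'⟩ := reflTransGen_commute (fun _ _ _ => ExpandStep.diamond) hD₁
    (ReflTransGen.head (Or.inr ⟨f⟩) hD₁')
  have hS := ReflTransGen.mono subdivideStep_le_elemMod
  have hE := ReflTransGen.mono expandStep_le_elemMod
  exact ⟨Λ, (hS _ _ hD).trans (hE _ _ hΛ), (hS _ _ hD').trans (hE _ _ hΛ')⟩

end SerreGraph

namespace SerreGraph

/-! ### Topological realizations -/

open unitInterval

section Realization

variable (Γ : SerreGraph)

instance : DiscreteTopology Γ.V := ⟨rfl⟩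
instance : DiscreteTopology Γ.E := ⟨rfl⟩

theorem bar_injective : Function.Injective Γ.bar :=
  Function.LeftInverse.injective Γ.bar_bar

theorem bar_eq_iff {e e' : Γ.E} : Γ.bar e = e' ↔ e = Γ.bar e' :=
  ⟨fun h => by rw [← h, Γ.bar_bar], fun h => by rw [h, Γ.bar_bar]⟩

theorem edgePoint_zero (e : Γ.E) : Γ.edgePoint e 0 = Γ.vertexPoint (Γ.ι e) :=
  Quot.sound (RealRel.endpoint e)

theorem edgePoint_bar (e : Γ.E) (t : I) : Γ.edgePoint (Γ.bar e) (σ t) = Γ.edgePoint e t :=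
  (Quot.sound (RealRel.flip e t)).symm

theorem edgePoint_bar' (e : Γ.E) (t : I) : Γ.edgePoint (Γ.bar e) t = Γ.edgePoint e (σ t) := by
  rw [← Γ.edgePoint_bar e (σ t), symm_symm]

theorem edgePoint_one (e : Γ.E) : Γ.edgePoint e 1 = Γ.vertexPoint (Γ.ι (Γ.bar e)) := by
  rw [← edgePoint_zero, edgePoint_bar', symm_zero]

theorem continuous_edgePoint (e : Γ.E) : Continuous (Γ.edgePoint e) :=
  continuous_quot_mk.comp (continuous_inr.comp (Continuous.prodMk_right e))

/-- Every point of the realization is a vertex or lies on an edge. -/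
theorem realization_cases {p : Γ.Realization → Prop} (hv : ∀ v, p (Γ.vertexPoint v))
    (he : ∀ e t, p (Γ.edgePoint e t)) (x : Γ.Realization) : p x := by
  rcases x with ⟨v | ⟨e, t⟩⟩
  exacts [hv v, he e t]

variable {Γ} {X : Type*} [TopologicalSpace X]

/-- The continuous map out of a realization given by its values on vertices and edges. -/
def Realization.lift (fV : Γ.V → X) (fE : Γ.E → C(I, X)) (h₀ : ∀ e, fE e 0 = fV (Γ.ι e))
    (hbar : ∀ e t, fE e t = fE (Γ.bar e) (σ t)) : C(Γ.Realization, X) where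
  toFun := Quot.lift (Sum.elim fV fun p => fE p.1 p.2) (by
    rintro _ _ (e | ⟨e, t⟩)
    exacts [h₀ e, hbar e t])
  continuous_toFun := continuous_quot_lift _ <| continuous_of_discreteTopology.sumElim <|
    continuous_prod_of_discrete_left.2 fun e => (fE e).continuous

/-- Mutually inverse continuous maps between subspaces of two spaces give a homeomorphism. -/
theorem nonempty_homeomorph_of_invOn {Y : Type*} [TopologicalSpace Y] {A : Set X} {B : Set Y}
    (f : C(X, Y)) (g : C(Y, X)) (hf : Set.MapsTo f A B) (hg : Set.MapsTo g B A)
    (h : Set.InvOn g f A B) : Nonempty (A ≃ₜ B) :=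
  ⟨{ toFun := hf.restrict
     invFun := hg.restrict
     left_inv := fun x => Subtype.ext (h.1 x.2)
     right_inv := fun y => Subtype.ext (h.2 y.2)
     continuous_toFun := f.continuous.continuousOn.mapsToRestrict hf
     continuous_invFun := g.continuous.continuousOn.mapsToRestrict hg }⟩

end Realization

theorem edgePoint_mem_coreRealization {Γ : SerreGraph} {e : Γ.E} (he : e ∈ Γ.coreEdges) (t : I) :
    Γ.edgePoint e t ∈ Γ.coreRealization :=
  ⟨e, he, t, rfl⟩

theorem bar_mem_coreEdges {Γ : SerreGraph} {e : Γ.E} (he : e ∈ Γ.coreEdges) :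
    Γ.bar e ∈ Γ.coreEdges := by
  obtain ⟨S, he, hS, h⟩ := he
  exact ⟨S, hS e he, hS, h⟩

/-! ### Isomorphisms and realizations -/

namespace Iso

variable {Γ Δ : SerreGraph}

/-- The map of realizations induced by an isomorphism. -/
def realizationMap (f : Iso Γ Δ) : C(Γ.Realization, Δ.Realization) :=
  Realization.lift (fun v => Δ.vertexPoint (f.vEquiv v))
    (fun e => ⟨Δ.edgePoint (f.eEquiv e), Δ.continuous_edgePoint _⟩)
    (fun e => by simp [edgePoint_zero, f.map_ι])
    (fun e t => by simp [f.map_bar, edgePoint_bar])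

theorem eEquiv_mem_coreEdges (f : Iso Γ Δ) {e : Γ.E} (he : e ∈ Γ.coreEdges) :
    f.eEquiv e ∈ Δ.coreEdges := by
  obtain ⟨S, he, hS, h⟩ := he
  refine ⟨f.eEquiv '' S, Set.mem_image_of_mem _ he, ?_, ?_⟩
  · rintro _ ⟨a, ha, rfl⟩
    exact ⟨_, hS a ha, f.map_bar a⟩
  · rintro _ ⟨a, ha, rfl⟩
    obtain ⟨b, hb, hba, hι⟩ := h a ha
    exact ⟨_, Set.mem_image_of_mem _ hb, f.eEquiv.injective.ne hba, by
      rw [← f.map_ι, ← f.map_ι, hι]⟩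

theorem mapsTo_realizationMap (f : Iso Γ Δ) :
    Set.MapsTo f.realizationMap Γ.coreRealization Δ.coreRealization := by
  rintro _ ⟨e, he, t, rfl⟩
  exact edgePoint_mem_coreRealization (f.eEquiv_mem_coreEdges he) t

theorem leftInverse_realizationMap (f : Iso Γ Δ) :
    Function.LeftInverse f.symm.realizationMap f.realizationMap := by
  refine realization_cases Γ (fun v => ?_) fun e t => ?_
  · exact congrArg Γ.vertexPoint (f.vEquiv.symm_apply_apply v)
  · exact congrArg (Γ.edgePoint · t) (f.eEquiv.symm_apply_apply e)

theorem nonempty_coreRealization_homeomorph (f : Iso Γ Δ) :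
    Nonempty (Γ.coreRealization ≃ₜ Δ.coreRealization) :=
  nonempty_homeomorph_of_invOn f.realizationMap f.symm.realizationMap f.mapsTo_realizationMap
    f.symm.mapsTo_realizationMap ⟨fun x _ => f.leftInverse_realizationMap x,
      fun x _ => f.symm.leftInverse_realizationMap x⟩

end Iso

/-! ### Expansions and realizations -/

section Expand

variable (Γ : SerreGraph) (u : Γ.V)

/-- The inclusion of `|Γ|` in the realization of an expansion. -/
def toExpand : C(Γ.Realization, (Γ.expand u).Realization) :=
  Realization.lift (fun v => (Γ.expand u).vertexPoint (some v))
    (fun e => ⟨(Γ.expand u).edgePoint (Sum.inl e), continuous_edgePoint _ _⟩)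
    (fun e => edgePoint_zero (Γ.expand u) (Sum.inl e))
    (fun e t => (edgePoint_bar (Γ.expand u) (Sum.inl e) t).symm)

/-- The retraction of the realization of an expansion onto `|Γ|`. -/
def ofExpand : C((Γ.expand u).Realization, Γ.Realization) :=
  Realization.lift (fun v => Γ.vertexPoint (v.getD u))
    (Sum.elim (fun e => ⟨Γ.edgePoint e, continuous_edgePoint _ _⟩)
      fun _ => ContinuousMap.const _ (Γ.vertexPoint u))
    (by
      rintro (e | _ | _)
      exacts [edgePoint_zero Γ e, rfl, rfl])
    (by
      rintro (e | b) t
      exacts [(edgePoint_bar Γ e t).symm, rfl])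

variable {Γ u}

theorem inl_mem_coreEdges_expand {e : Γ.E} :
    (Sum.inl e : (Γ.expand u).E) ∈ (Γ.expand u).coreEdges ↔ e ∈ Γ.coreEdges := by
  constructor
  · rintro ⟨S, he, hS, h⟩
    have hb (b : Bool) : (Sum.inr b : (Γ.expand u).E) ∉ S := by
      intro hb
      have h0 : (Sum.inr false : (Γ.expand u).E) ∈ S := by
        cases b
        exacts [hb, hS _ hb]
      obtain ⟨a | _ | _, -, hne, hι⟩ := h _ h0
      exacts [Option.some_ne_none _ hι, hne rfl, Option.some_ne_none _ hι]
    refine ⟨Sum.inl ⁻¹' S, he, fun a ha => hS _ ha, fun a ha => ?_⟩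
    obtain ⟨b | b, hbS, hne, hι⟩ := h _ ha
    · exact ⟨b, hbS, fun h => hne (congrArg Sum.inl h), Option.some_injective _ hι⟩
    · exact (hb b hbS).elim
  · rintro ⟨S, he, hS, h⟩
    refine ⟨Sum.inl '' S, Set.mem_image_of_mem _ he, ?_, ?_⟩
    · rintro _ ⟨a, ha, rfl⟩
      exact ⟨_, hS a ha, rfl⟩
    · rintro _ ⟨a, ha, rfl⟩
      obtain ⟨b, hb, hba, hι⟩ := h a ha
      exact ⟨_, Set.mem_image_of_mem _ hb, Sum.inl_injective.ne hba, congrArg some hι⟩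

theorem inr_notMem_coreEdges_expand (b : Bool) :
    (Sum.inr b : (Γ.expand u).E) ∉ (Γ.expand u).coreEdges := by
  rintro ⟨S, he, hS, h⟩
  have h0 : (Sum.inr false : (Γ.expand u).E) ∈ S := by
    cases b
    exacts [he, hS _ he]
  obtain ⟨a | _ | _, -, hne, hι⟩ := h _ h0
  exacts [Option.some_ne_none _ hι, hne rfl, Option.some_ne_none _ hι]

variable (Γ u)

theorem nonempty_coreRealization_homeomorph_expand :
    Nonempty (Γ.coreRealization ≃ₜ (Γ.expand u).coreRealization) := by
  refine nonempty_homeomorph_of_invOn (Γ.toExpand u) (Γ.ofExpand u) ?_ ?_ ⟨?_, ?_⟩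
  · rintro _ ⟨e, he, t, rfl⟩
    exact edgePoint_mem_coreRealization (inl_mem_coreEdges_expand.2 he) t
  · rintro _ ⟨e | b, he, t, rfl⟩
    · exact edgePoint_mem_coreRealization (inl_mem_coreEdges_expand.1 he) t
    · exact (inr_notMem_coreEdges_expand b he).elim
  · rintro _ ⟨e, he, t, rfl⟩
    rfl
  · rintro _ ⟨e | b, he, t, rfl⟩
    · rfl
    · exact (inr_notMem_coreEdges_expand b he).elim

end Expand

/-! ### Subdivisions and realizations -/

section Subdivide

/-- A point of the unit interval lies in one of the two parts cut out by `t₀`. -/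
theorem exists_eq_mul_or_symm_mul {t₀ : I} (h0 : t₀ ≠ 0) (h1 : t₀ ≠ 1) (t : I) :
    (∃ s, t = t₀ * s) ∨ ∃ s, t = σ (σ t₀ * σ s) := by
  have h0 := pos_iff_ne_zero.2 h0
  have h1 := unitInterval.lt_one_iff_ne_one.2 h1
  have h0' : (0 : ℝ) < t₀ := h0
  have h1' : (0 : ℝ) < 1 - t₀ := sub_pos.2 h1
  rcases le_total t t₀ with h | h
  · refine Or.inl ⟨⟨t / t₀, div_nonneg t.2.1 h0'.le, (div_le_one h0').2 h⟩, Subtype.ext ?_⟩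
    simp only [Set.Icc.coe_mul]
    field_simp
  · refine Or.inr ⟨⟨(t - t₀) / (1 - t₀), div_nonneg (sub_nonneg.2 h) h1'.le,
      (div_le_one h1').2 (sub_le_sub_right t.2.2 _)⟩, Subtype.ext ?_⟩
    simp only [Set.Icc.coe_mul, coe_symm_eq]
    field_simp
    ring

variable (Γ : SerreGraph) (e₀ : Γ.E) (t₀ : I)

/-- An edge of `Γ` persisting in the subdivision. -/
def oldEdge (e : {e : Γ.E // e ≠ e₀ ∧ e ≠ Γ.bar e₀}) : (Γ.subdivide e₀).E := Sum.inl e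

/-- An edge of the subdivision contained in the subdivided edge. -/
def halfEdge (p : Bool × Bool) : (Γ.subdivide e₀).E := Sum.inr p

theorem halfEdge_injective : Function.Injective (Γ.halfEdge e₀) := Sum.inr_injective

/-- The edge of a subdivision starting at the same vertex as a given edge. -/
noncomputable def initialEdge (e : Γ.E) : (Γ.subdivide e₀).E :=
  open Classical in
  if h₀ : e = e₀ then Γ.halfEdge e₀ (false, false)
  else if h₁ : e = Γ.bar e₀ then Γ.halfEdge e₀ (true, true) else Γ.oldEdge e₀ ⟨e, h₀, h₁⟩

theorem initialEdge_self : Γ.initialEdge e₀ e₀ = Γ.halfEdge e₀ (false, false) := by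
  simp [initialEdge]

theorem initialEdge_bar_self : Γ.initialEdge e₀ (Γ.bar e₀) = Γ.halfEdge e₀ (true, true) := by
  simp [initialEdge, Γ.bar_ne]

theorem initialEdge_val (e : {e : Γ.E // e ≠ e₀ ∧ e ≠ Γ.bar e₀}) :
    Γ.initialEdge e₀ e.1 = Γ.oldEdge e₀ e := by
  simp [initialEdge, e.2.1, e.2.2]

theorem initialEdge_bar_val (e : {e : Γ.E // e ≠ e₀ ∧ e ≠ Γ.bar e₀}) :
    Γ.initialEdge e₀ (Γ.bar e.1) = (Γ.subdivide e₀).bar (Γ.oldEdge e₀ e) := by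
  have h : Γ.bar e.1 ≠ e₀ := fun h => e.2.2 (Γ.bar_eq_iff.1 h)
  have h' : Γ.bar e.1 ≠ Γ.bar e₀ := fun h => e.2.1 (Γ.bar_injective h)
  exact Γ.initialEdge_val e₀ ⟨Γ.bar e.1, h, h'⟩

/-- An edge is one of the subdivided edges or persists. -/
theorem subdivide_edge_cases {p : Γ.E → Prop} (h₀ : p e₀) (h₁ : p (Γ.bar e₀))
    (h : ∀ e : {e : Γ.E // e ≠ e₀ ∧ e ≠ Γ.bar e₀}, p e.1) (e : Γ.E) : p e := by
  by_cases h0 : e = e₀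
  · exact h0 ▸ h₀
  by_cases h1 : e = Γ.bar e₀
  · exact h1 ▸ h₁
  exact h ⟨e, h0, h1⟩

theorem ι_initialEdge (e : Γ.E) : (Γ.subdivide e₀).ι (Γ.initialEdge e₀ e) = some (Γ.ι e) := by
  induction e using Γ.subdivide_edge_cases e₀ with
  | h₀ => rw [initialEdge_self]; rfl
  | h₁ => rw [initialEdge_bar_self]; rfl
  | h e => rw [initialEdge_val]; rfl

theorem initialEdge_injective : Function.Injective (Γ.initialEdge e₀) := by
  intro e e' h
  unfold initialEdge at h
  split_ifs at h with h1 h2 h3 h4 h5 h6 h7 h8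
  · rw [h1, h2]
  · simpa using Γ.halfEdge_injective e₀ h
  · exact (Sum.inr_ne_inl h).elim
  · simpa using Γ.halfEdge_injective e₀ h
  · rw [h4, h6]
  · exact (Sum.inr_ne_inl h).elim
  · exact (Sum.inl_ne_inr h).elim
  · exact (Sum.inl_ne_inr h).elim
  · exact congrArg Subtype.val (Sum.inl_injective h)

theorem exists_initialEdge_eq {a : (Γ.subdivide e₀).E} (ha : (Γ.subdivide e₀).ι a ≠ none) :
    ∃ e, Γ.initialEdge e₀ e = a := by
  rcases a with e | ⟨_ | _, _ | _⟩
  · exact ⟨_, Γ.initialEdge_val e₀ e⟩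
  · exact ⟨_, Γ.initialEdge_self e₀⟩
  · exact (ha rfl).elim
  · exact (ha rfl).elim
  · exact ⟨_, Γ.initialEdge_bar_self e₀⟩

theorem initialEdge_mem_coreEdges {e : Γ.E} :
    Γ.initialEdge e₀ e ∈ (Γ.subdivide e₀).coreEdges ↔ e ∈ Γ.coreEdges := by
  constructor
  · rintro ⟨S, he, hS, h⟩
    have h₁ : Γ.halfEdge e₀ (false, false) ∈ S →
        Γ.halfEdge e₀ (true, true) ∈ S := by
      intro h0
      obtain ⟨a | ⟨_ | _, _ | _⟩, haS, hne, hι⟩ := h _ (hS _ h0)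
      exacts [(Option.some_ne_none _ hι).elim, (Option.some_ne_none _ hι).elim, (hne rfl).elim,
        hS _ haS, (Option.some_ne_none _ hι).elim]
    have h₂ : Γ.halfEdge e₀ (true, true) ∈ S →
        Γ.halfEdge e₀ (false, false) ∈ S := by
      intro h0
      obtain ⟨a | ⟨_ | _, _ | _⟩, haS, hne, hι⟩ := h _ (hS _ h0)
      exacts [(Option.some_ne_none _ hι).elim, (Option.some_ne_none _ hι).elim, hS _ haS,
        (hne rfl).elim, (Option.some_ne_none _ hι).elim]
    refine ⟨Γ.initialEdge e₀ ⁻¹' S, he, ?_, ?_⟩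
    · intro a ha
      simp only [Set.mem_preimage] at ha ⊢
      induction a using Γ.subdivide_edge_cases e₀ with
      | h₀ =>
        rw [initialEdge_self] at ha
        rw [initialEdge_bar_self]
        exact h₁ ha
      | h₁ =>
        rw [initialEdge_bar_self] at ha
        rw [Γ.bar_bar, initialEdge_self]
        exact h₂ ha
      | h a =>
        rw [initialEdge_val] at ha
        rw [initialEdge_bar_val]
        exact hS _ ha
    · intro a ha
      obtain ⟨b, hb, hne, hι⟩ := h _ ha
      rw [ι_initialEdge] at hι
      obtain ⟨b, rfl⟩ := Γ.exists_initialEdge_eq e₀ (hι ▸ Option.some_ne_none _)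
      rw [ι_initialEdge] at hι
      exact ⟨b, hb, fun h => hne (congrArg _ h), Option.some_injective _ hι⟩
  · rintro ⟨S, he, hS, h⟩
    have key : ∀ a ∈ S, (Γ.subdivide e₀).bar (Γ.initialEdge e₀ a) ∈
        Γ.initialEdge e₀ '' S ∪ {a | (Γ.subdivide e₀).ι a = none ∧ e₀ ∈ S} := by
      intro a ha
      induction a using Γ.subdivide_edge_cases e₀ with
      | h₀ =>
        rw [initialEdge_self]
        exact Or.inr ⟨rfl, ha⟩
      | h₁ =>
        rw [initialEdge_bar_self]
        exact Or.inr ⟨rfl, by simpa [Γ.bar_bar] using hS _ ha⟩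
      | h a =>
        rw [initialEdge_val]
        exact Or.inl ⟨_, hS _ ha, Γ.initialEdge_bar_val e₀ _⟩
    refine ⟨Γ.initialEdge e₀ '' S ∪ {a | (Γ.subdivide e₀).ι a = none ∧ e₀ ∈ S},
      Or.inl (Set.mem_image_of_mem _ he), ?_, ?_⟩
    · rintro _ (⟨a, ha, rfl⟩ | ⟨ha, h0⟩)
      · exact key a ha
      · rename_i a
        rcases a with e | ⟨_ | _, _ | _⟩
        · exact (Option.some_ne_none _ ha).elim
        · exact (Option.some_ne_none _ ha).elim
        · exact Or.inl ⟨_, h0, Γ.initialEdge_self e₀⟩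
        · exact Or.inl ⟨_, hS _ h0, Γ.initialEdge_bar_self e₀⟩
        · exact (Option.some_ne_none _ ha).elim
    · rintro _ (⟨a, ha, rfl⟩ | ⟨ha, h0⟩)
      · obtain ⟨b, hb, hba, hι⟩ := h a ha
        exact ⟨_, Or.inl (Set.mem_image_of_mem _ hb), (Γ.initialEdge_injective e₀).ne hba, by
          rw [ι_initialEdge, ι_initialEdge, hι]⟩
      · rename_i a
        rcases a with e | ⟨_ | _, _ | _⟩
        · exact (Option.some_ne_none _ ha).elim
        · exact (Option.some_ne_none _ ha).elim
        · exact ⟨Γ.halfEdge e₀ (true, false), Or.inr ⟨rfl, h0⟩,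
            (Γ.halfEdge_injective e₀).ne (by simp), rfl⟩
        · exact ⟨Γ.halfEdge e₀ (false, true), Or.inr ⟨rfl, h0⟩,
            (Γ.halfEdge_injective e₀).ne (by simp), rfl⟩
        · exact (Option.some_ne_none _ ha).elim

theorem inl_mem_coreEdges_subdivide (e : {e : Γ.E // e ≠ e₀ ∧ e ≠ Γ.bar e₀}) :
    Γ.oldEdge e₀ e ∈ (Γ.subdivide e₀).coreEdges ↔ e.1 ∈ Γ.coreEdges := by
  rw [← initialEdge_val, initialEdge_mem_coreEdges]

theorem inr_mem_coreEdges_subdivide (p : Bool × Bool) :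
    Γ.halfEdge e₀ p ∈ (Γ.subdivide e₀).coreEdges ↔ e₀ ∈ Γ.coreEdges := by
  have bar_iff (Δ : SerreGraph) (e : Δ.E) : Δ.bar e ∈ Δ.coreEdges ↔ e ∈ Δ.coreEdges :=
    ⟨fun h => Δ.bar_bar e ▸ bar_mem_coreEdges h, bar_mem_coreEdges⟩
  have h0 := Γ.initialEdge_mem_coreEdges e₀ (e := e₀)
  have h1 := Γ.initialEdge_mem_coreEdges e₀ (e := Γ.bar e₀)
  rw [initialEdge_self] at h0
  rw [initialEdge_bar_self, bar_iff] at h1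
  rcases p with ⟨_ | _, _ | _⟩
  · exact h0
  · exact (bar_iff (Γ.subdivide e₀) (Sum.inr (false, false))).trans h0
  · exact (bar_iff (Γ.subdivide e₀) (Sum.inr (true, true))).trans h1
  · exact h1

/-- The map of realizations placing the new vertex of a subdivision at the parameter `t₀`. -/
def ofSubdivide : C((Γ.subdivide e₀).Realization, Γ.Realization) :=
  Realization.lift (fun v => v.elim (Γ.edgePoint e₀ t₀) Γ.vertexPoint)
    (fun a => ⟨fun s => match a with
      | Sum.inl e => Γ.edgePoint e.1 s
      | Sum.inr (false, false) => Γ.edgePoint e₀ (t₀ * s)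
      | Sum.inr (false, true) => Γ.edgePoint e₀ (t₀ * σ s)
      | Sum.inr (true, false) => Γ.edgePoint e₀ (σ (σ t₀ * σ s))
      | Sum.inr (true, true) => Γ.edgePoint e₀ (σ (σ t₀ * s)), by
        rcases a with e | ⟨_ | _, _ | _⟩ <;>
          exact (Γ.continuous_edgePoint _).comp (by fun_prop)⟩)
    (by
      rintro (e | ⟨_ | _, _ | _⟩) <;>
        simp [subdivide, edgePoint_zero, edgePoint_one])
    (by
      rintro (e | ⟨_ | _, _ | _⟩) t <;>
        simp [subdivide, edgePoint_bar])

theorem edgePoint_halfEdge_one : (Γ.subdivide e₀).edgePoint (Γ.halfEdge e₀ (false, false)) 1 =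
    (Γ.subdivide e₀).edgePoint (Γ.halfEdge e₀ (true, false)) 0 := by
  rw [edgePoint_one, edgePoint_zero]
  rfl

/-- The path through the two halves of a subdivided edge. -/
noncomputable def subdividePath (h0 : t₀ ≠ 0) (h1 : t₀ ≠ 1) :
    C(I, (Γ.subdivide e₀).Realization) where
  toFun t := if t ≤ t₀ then
      (Γ.subdivide e₀).edgePoint (Γ.halfEdge e₀ (false, false))
        (Set.projIcc 0 1 zero_le_one (t / t₀ : ℝ))
    else (Γ.subdivide e₀).edgePoint (Γ.halfEdge e₀ (true, false))
      (Set.projIcc 0 1 zero_le_one ((t - t₀) / (1 - t₀) : ℝ))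
  continuous_toFun := by
    refine Continuous.if_le ?_ ?_ continuous_id continuous_const ?_
    · exact (continuous_edgePoint _ _).comp (continuous_projIcc.comp (by fun_prop))
    · exact (continuous_edgePoint _ _).comp (continuous_projIcc.comp (by fun_prop))
    · rintro t rfl
      have : (t : ℝ) ≠ 0 := fun h => h0 (Subtype.ext h)
      rw [div_self this, sub_self, zero_div, Set.projIcc_right, Set.projIcc_left]
      exact Γ.edgePoint_halfEdge_one e₀

variable {t₀} (h0 : t₀ ≠ 0) (h1 : t₀ ≠ 1)

theorem subdividePath_mul (s : I) : Γ.subdividePath e₀ t₀ h0 h1 (t₀ * s) =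
    (Γ.subdivide e₀).edgePoint (Γ.halfEdge e₀ (false, false)) s := by
  have h : (t₀ : ℝ) ≠ 0 := fun h => h0 (Subtype.ext h)
  have hle : t₀ * s ≤ t₀ := mul_le_left
  simp only [subdividePath, ContinuousMap.coe_mk, if_pos hle]
  rw [Set.Icc.coe_mul, mul_div_cancel_left₀ _ h, Set.projIcc_val]

theorem subdividePath_symm_mul (s : I) : Γ.subdividePath e₀ t₀ h0 h1 (σ (σ t₀ * σ s)) =
    (Γ.subdivide e₀).edgePoint (Γ.halfEdge e₀ (true, false)) s := by
  have h : (1 - t₀ : ℝ) ≠ 0 := fun h => h1 (Subtype.ext (sub_eq_zero.1 h).symm)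
  by_cases hs : s = 0
  · subst hs
    have := Γ.subdividePath_mul e₀ h0 h1 1
    rw [mul_one] at this
    rw [symm_zero, mul_one, symm_symm, this]
    exact Γ.edgePoint_halfEdge_one e₀
  · have hlt : ¬ σ (σ t₀ * σ s) ≤ t₀ := by
      have hs : (0 : ℝ) < s := unitInterval.pos_iff_ne_zero.2 hs
      have h1 : (t₀ : ℝ) < 1 := unitInterval.lt_one_iff_ne_one.2 h1
      rw [not_le, ← Subtype.coe_lt_coe]
      simp only [coe_symm_eq, Set.Icc.coe_mul]
      nlinarith
    simp only [subdividePath, ContinuousMap.coe_mk, if_neg hlt]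
    congr 1
    rw [← Set.projIcc_val zero_le_one s]
    congr 1
    simp only [coe_symm_eq, Set.Icc.coe_mul, Set.projIcc_val]
    field_simp
    ring

open Classical in
/-- The inverse of `ofSubdivide`. -/
noncomputable def toSubdivide : C(Γ.Realization, (Γ.subdivide e₀).Realization) :=
  Realization.lift (fun v => (Γ.subdivide e₀).vertexPoint (some v))
    (fun e => if h : e = e₀ then Γ.subdividePath e₀ t₀ h0 h1
      else if h' : e = Γ.bar e₀ then (Γ.subdividePath e₀ t₀ h0 h1).comp ⟨σ, by fun_prop⟩
      else ⟨(Γ.subdivide e₀).edgePoint (Γ.oldEdge e₀ ⟨e, h, h'⟩), continuous_edgePoint _ _⟩)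
    (by
      refine Γ.subdivide_edge_cases e₀ ?_ ?_ fun e => ?_
      · have hp := Γ.subdividePath_mul e₀ h0 h1 0
        rw [edgePoint_zero, mul_zero] at hp
        rw [dif_pos rfl]
        exact hp
      · have hp := Γ.subdividePath_symm_mul e₀ h0 h1 1
        rw [edgePoint_one, symm_one, mul_zero, symm_zero] at hp
        rw [dif_neg (Γ.bar_ne e₀), dif_pos rfl]
        exact (congrArg _ symm_zero).trans hp
      · rw [dif_neg e.2.1, dif_neg e.2.2]
        exact edgePoint_zero _ _)
    (by
      refine Γ.subdivide_edge_cases e₀ ?_ ?_ fun e => ?_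
      · simp [Γ.bar_ne]
      · simp [Γ.bar_ne, Γ.bar_bar]
      · intro t
        have h : Γ.bar e.1 ≠ e₀ := fun h => e.2.2 (Γ.bar_eq_iff.1 h)
        have h' : Γ.bar e.1 ≠ Γ.bar e₀ := fun h => e.2.1 (Γ.bar_injective h)
        rw [dif_neg e.2.1, dif_neg e.2.2, dif_neg h, dif_neg h']
        exact (edgePoint_bar (Γ.subdivide e₀) (Γ.oldEdge e₀ e) t).symm)

theorem toSubdivide_edgePoint_self (t : I) :
    Γ.toSubdivide e₀ h0 h1 (Γ.edgePoint e₀ t) = Γ.subdividePath e₀ t₀ h0 h1 t :=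
  congrArg (fun f : C(I, (Γ.subdivide e₀).Realization) => f t) (dif_pos rfl)

theorem toSubdivide_edgePoint (e : {e : Γ.E // e ≠ e₀ ∧ e ≠ Γ.bar e₀}) (t : I) :
    Γ.toSubdivide e₀ h0 h1 (Γ.edgePoint e.1 t) = (Γ.subdivide e₀).edgePoint (Γ.oldEdge e₀ e) t := by
  change (@dite C(I, (Γ.subdivide e₀).Realization) (e.1 = e₀) (Classical.propDecidable _) _ _) t = _
  rw [dif_neg e.2.1, dif_neg e.2.2]
  rfl

/-- The homeomorphism between the realization of a graph and that of a subdivision, placing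
the new vertex at a given interior point of the subdivided edge. -/
noncomputable def subdivideHomeomorph : Γ.Realization ≃ₜ (Γ.subdivide e₀).Realization where
  toFun := Γ.toSubdivide e₀ h0 h1
  invFun := Γ.ofSubdivide e₀ t₀
  left_inv := by
    have h (t : I) : Γ.ofSubdivide e₀ t₀ (Γ.toSubdivide e₀ h0 h1 (Γ.edgePoint e₀ t)) =
        Γ.edgePoint e₀ t := by
      rw [toSubdivide_edgePoint_self]
      rcases exists_eq_mul_or_symm_mul h0 h1 t with ⟨s, rfl⟩ | ⟨s, rfl⟩
      · rw [subdividePath_mul]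
        rfl
      · rw [subdividePath_symm_mul]
        rfl
    refine realization_cases Γ (fun v => rfl) ?_
    refine Γ.subdivide_edge_cases e₀ h (fun t => ?_) fun e t => ?_
    · rw [edgePoint_bar', h]
    · rw [toSubdivide_edgePoint]
      rfl
  right_inv := by
    have hff (s : I) : Γ.toSubdivide e₀ h0 h1 (Γ.ofSubdivide e₀ t₀
        ((Γ.subdivide e₀).edgePoint (Γ.halfEdge e₀ (false, false)) s)) =
        (Γ.subdivide e₀).edgePoint (Γ.halfEdge e₀ (false, false)) s :=
      (Γ.toSubdivide_edgePoint_self e₀ h0 h1 _).trans (Γ.subdividePath_mul e₀ h0 h1 s)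
    have htf (s : I) : Γ.toSubdivide e₀ h0 h1 (Γ.ofSubdivide e₀ t₀
        ((Γ.subdivide e₀).edgePoint (Γ.halfEdge e₀ (true, false)) s)) =
        (Γ.subdivide e₀).edgePoint (Γ.halfEdge e₀ (true, false)) s :=
      (Γ.toSubdivide_edgePoint_self e₀ h0 h1 _).trans (Γ.subdividePath_symm_mul e₀ h0 h1 s)
    have hnone : (Γ.subdivide e₀).vertexPoint none =
        (Γ.subdivide e₀).edgePoint (Γ.halfEdge e₀ (true, false)) 0 :=
      (edgePoint_zero (Γ.subdivide e₀) (Sum.inr (true, false))).symm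
    have hfalse (s : I) : Γ.toSubdivide e₀ h0 h1 (Γ.ofSubdivide e₀ t₀
        ((Γ.subdivide e₀).edgePoint (Γ.halfEdge e₀ (false, true)) s)) =
        (Γ.subdivide e₀).edgePoint (Γ.halfEdge e₀ (false, true)) s := by
      have : (Γ.subdivide e₀).edgePoint (Γ.halfEdge e₀ (false, true)) s =
        (Γ.subdivide e₀).edgePoint (Γ.halfEdge e₀ (false, false)) (σ s) :=
        edgePoint_bar' _ (Γ.halfEdge e₀ (false, false)) s
      rw [this, hff]
    have htrue (s : I) : Γ.toSubdivide e₀ h0 h1 (Γ.ofSubdivide e₀ t₀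
        ((Γ.subdivide e₀).edgePoint (Γ.halfEdge e₀ (true, true)) s)) =
        (Γ.subdivide e₀).edgePoint (Γ.halfEdge e₀ (true, true)) s := by
      have : (Γ.subdivide e₀).edgePoint (Γ.halfEdge e₀ (true, true)) s =
        (Γ.subdivide e₀).edgePoint (Γ.halfEdge e₀ (true, false)) (σ s) :=
        edgePoint_bar' _ (Γ.halfEdge e₀ (true, false)) s
      rw [this, htf]
    refine realization_cases _ ?_ ?_
    · rintro (_ | v)
      · rw [hnone, htf]
      · rfl
    · rintro (e | ⟨_ | _, _ | _⟩) t
      · exact Γ.toSubdivide_edgePoint e₀ h0 h1 e t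
      · exact hff t
      · exact hfalse t
      · exact htf t
      · exact htrue t
  continuous_toFun := (Γ.toSubdivide e₀ h0 h1).continuous
  continuous_invFun := (Γ.ofSubdivide e₀ t₀).continuous

theorem subdivideHomeomorph_apply (x : Γ.Realization) :
    Γ.subdivideHomeomorph e₀ h0 h1 x = Γ.toSubdivide e₀ h0 h1 x :=
  rfl

theorem subdivideHomeomorph_vertexPoint (v : Γ.V) :
    Γ.subdivideHomeomorph e₀ h0 h1 (Γ.vertexPoint v) = (Γ.subdivide e₀).vertexPoint (some v) :=
  rfl

theorem subdivideHomeomorph_edgePoint :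
    Γ.subdivideHomeomorph e₀ h0 h1 (Γ.edgePoint e₀ t₀) = (Γ.subdivide e₀).vertexPoint none :=
  (Γ.subdivideHomeomorph e₀ h0 h1).eq_symm_apply.1 rfl

theorem nonempty_coreRealization_homeomorph_subdivide :
    Nonempty (Γ.coreRealization ≃ₜ (Γ.subdivide e₀).coreRealization) := by
  obtain ⟨t₀, h0, h1⟩ : ∃ t : I, t ≠ 0 ∧ t ≠ 1 :=
    ⟨⟨1 / 2, by norm_num, by norm_num⟩, by simp [Subtype.ext_iff], by simp [Subtype.ext_iff]⟩
  let φ := Γ.subdivideHomeomorph e₀ h0 h1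
  have core_e₀ (he : e₀ ∈ Γ.coreEdges) (t : I) :
      φ (Γ.edgePoint e₀ t) ∈ (Γ.subdivide e₀).coreRealization := by
    rw [subdivideHomeomorph_apply, toSubdivide_edgePoint_self]
    rcases exists_eq_mul_or_symm_mul h0 h1 t with ⟨s, rfl⟩ | ⟨s, rfl⟩
    · rw [subdividePath_mul]
      exact edgePoint_mem_coreRealization ((Γ.inr_mem_coreEdges_subdivide e₀ _).2 he) _
    · rw [subdividePath_symm_mul]
      exact edgePoint_mem_coreRealization ((Γ.inr_mem_coreEdges_subdivide e₀ _).2 he) _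
  refine nonempty_homeomorph_of_invOn (φ : C(_, _)) (φ.symm : C(_, _)) ?_ ?_
    ⟨fun x _ => φ.symm_apply_apply x, fun x _ => φ.apply_symm_apply x⟩
  · rintro _ ⟨e, he, t, rfl⟩
    induction e using Γ.subdivide_edge_cases e₀ with
    | h₀ => exact core_e₀ he t
    | h₁ =>
      rw [edgePoint_bar']
      exact core_e₀ (Γ.bar_bar e₀ ▸ bar_mem_coreEdges he) _
    | h e =>
      change φ _ ∈ (Γ.subdivide e₀).coreRealization
      rw [subdivideHomeomorph_apply, toSubdivide_edgePoint]
      exact edgePoint_mem_coreRealization ((Γ.inl_mem_coreEdges_subdivide e₀ e).2 he) t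
  · rintro _ ⟨e | p, he, t, rfl⟩
    · exact edgePoint_mem_coreRealization ((Γ.inl_mem_coreEdges_subdivide e₀ e).1 he) t
    · have := (Γ.inr_mem_coreEdges_subdivide e₀ _).1 he
      rcases p with ⟨_ | _, _ | _⟩ <;> exact edgePoint_mem_coreRealization this _

end Subdivide

theorem ElemMod.nonempty_coreRealization_homeomorph {Γ Δ : SerreGraph} (h : ElemMod Γ Δ) :
    Nonempty (Γ.coreRealization ≃ₜ Δ.coreRealization) := by
  rcases h with ⟨u, ⟨f⟩⟩ | ⟨e, ⟨f⟩⟩ | ⟨⟨f⟩⟩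
  · exact (Γ.nonempty_coreRealization_homeomorph_expand u).map2 .trans
      f.nonempty_coreRealization_homeomorph
  · exact (Γ.nonempty_coreRealization_homeomorph_subdivide e).map2 .trans
      f.nonempty_coreRealization_homeomorph
  · exact f.nonempty_coreRealization_homeomorph

theorem nonempty_coreRealization_homeomorph_of_reflTransGen {Γ Δ : SerreGraph}
    (h : Relation.ReflTransGen ElemMod Γ Δ) :
    Nonempty (Γ.coreRealization ≃ₜ Δ.coreRealization) := by
  induction h with
  | refl => exact ⟨Homeomorph.refl _⟩
  | tail _ h ih =>
    exact ih.map2 .trans h.nonempty_coreRealization_homeomorph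

end SerreGraph

namespace SerreGraph

/-! ### Open edges -/

open unitInterval Set

section OpenEdge

variable (Γ : SerreGraph)

open Classical in
/-- The representatives of a point of the realization; end points of edges are represented
by their vertices only. -/
noncomputable def representatives : Γ.Realization → Set (Γ.V ⊕ Γ.E × I) :=
  Quot.lift (Sum.elim (fun v => {Sum.inl v}) fun p =>
    if p.2 = 0 then {Sum.inl (Γ.ι p.1)} else if p.2 = 1 then {Sum.inl (Γ.ι (Γ.bar p.1))}
    else {Sum.inr p, Sum.inr (Γ.bar p.1, σ p.2)}) (by
      rintro _ _ (e | ⟨e, t⟩)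
      · simp
      · by_cases h0 : t = 0
        · simp [h0, Γ.bar_bar]
        by_cases h1 : t = 1
        · simp [h1]
        simp [h0, h1, Γ.bar_bar, pair_comm])

theorem representatives_vertexPoint (v : Γ.V) :
    Γ.representatives (Γ.vertexPoint v) = {Sum.inl v} :=
  rfl

theorem representatives_edgePoint (e : Γ.E) {t : I} (h0 : t ≠ 0) (h1 : t ≠ 1) :
    Γ.representatives (Γ.edgePoint e t) = {Sum.inr (e, t), Sum.inr (Γ.bar e, σ t)} :=
  (if_neg h0).trans (if_neg h1)

theorem vertexPoint_injective : Function.Injective Γ.vertexPoint := fun v w h => by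
  simpa [representatives_vertexPoint] using congrArg Γ.representatives h

theorem edgePoint_ne_vertexPoint (e : Γ.E) {t : I} (h0 : t ≠ 0) (h1 : t ≠ 1) (v : Γ.V) :
    Γ.edgePoint e t ≠ Γ.vertexPoint v := fun h => by
  have : Sum.inr (e, t) ∈ Γ.representatives (Γ.vertexPoint v) := by
    rw [← h, representatives_edgePoint Γ e h0 h1]
    exact mem_insert _ _
  exact Sum.inr_ne_inl this

/-- The open edge of the realization determined by an edge. -/
def openEdge (e : Γ.E) : Set Γ.Realization := Γ.edgePoint e '' Ioo 0 1

theorem edgePoint_mem_openEdge_iff {a e : Γ.E} {t : I} :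
    Γ.edgePoint a t ∈ Γ.openEdge e ↔ (a = e ∨ a = Γ.bar e) ∧ t ∈ Ioo 0 1 := by
  constructor
  · rintro ⟨s, hs, h⟩
    have hrep := Γ.representatives_edgePoint e hs.1.ne' hs.2.ne
    rw [h] at hrep
    by_cases h0 : t = 0
    · subst h0
      rw [edgePoint_zero] at h
      exact (Γ.edgePoint_ne_vertexPoint e hs.1.ne' hs.2.ne _ h).elim
    by_cases h1 : t = 1
    · subst h1
      rw [edgePoint_one] at h
      exact (Γ.edgePoint_ne_vertexPoint e hs.1.ne' hs.2.ne _ h).elim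
    refine ⟨?_, unitInterval.pos_iff_ne_zero.2 h0, unitInterval.lt_one_iff_ne_one.2 h1⟩
    rw [Γ.representatives_edgePoint a h0 h1] at hrep
    have hmem : (Sum.inr (a, t) : Γ.V ⊕ Γ.E × I) ∈
      ({Sum.inr (e, s), Sum.inr (Γ.bar e, σ s)} : Set _) := hrep ▸ mem_insert _ _
    simp only [mem_insert_iff, mem_singleton_iff, Sum.inr.injEq, Prod.mk.injEq] at hmem
    exact hmem.imp And.left And.left
  · rintro ⟨rfl | rfl, ht⟩
    · exact mem_image_of_mem _ ht
    · refine ⟨σ t, ?_, (Γ.edgePoint_bar' e t).symm⟩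
      rw [mem_Ioo, unitInterval.pos_iff_ne_zero, unitInterval.lt_one_iff_ne_one] at ht ⊢
      exact ⟨fun h => ht.2 (symm_eq_zero.1 h), fun h => ht.1 (symm_eq_one.1 h)⟩

theorem openEdge_nonempty (e : Γ.E) : (Γ.openEdge e).Nonempty :=
  (nonempty_Ioo.2 zero_lt_one).image _

theorem isPreconnected_openEdge (e : Γ.E) : IsPreconnected (Γ.openEdge e) :=
  isPreconnected_Ioo.image _ (Γ.continuous_edgePoint e).continuousOn

theorem openEdge_bar (e : Γ.E) : Γ.openEdge (Γ.bar e) = Γ.openEdge e := by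
  ext x
  induction x using realization_cases with
  | hv v =>
    have h (a : Γ.E) : Γ.vertexPoint v ∉ Γ.openEdge a := fun ⟨t, ht, h⟩ =>
      Γ.edgePoint_ne_vertexPoint a ht.1.ne' ht.2.ne v h
    simp [h]
  | he a t => simp [edgePoint_mem_openEdge_iff, Γ.bar_bar, or_comm]

theorem openEdge_eq_of_mem {a e : Γ.E} {x : Γ.Realization} (h : x ∈ Γ.openEdge a)
    (h' : x ∈ Γ.openEdge e) : a = e ∨ a = Γ.bar e := by
  obtain ⟨t, -, rfl⟩ := h
  exact (Γ.edgePoint_mem_openEdge_iff.1 h').1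

theorem vertexPoint_notMem_openEdge (v : Γ.V) (e : Γ.E) : Γ.vertexPoint v ∉ Γ.openEdge e :=
  fun ⟨_, ht, h⟩ => Γ.edgePoint_ne_vertexPoint e ht.1.ne' ht.2.ne v h

/-- A point which is not a vertex lies on an open edge. -/
theorem exists_mem_openEdge {x : Γ.Realization} (hx : x ∉ range Γ.vertexPoint) :
    ∃ e, x ∈ Γ.openEdge e := by
  induction x using realization_cases with
  | hv v => exact (hx ⟨v, rfl⟩).elim
  | he e t =>
    refine ⟨e, t, ⟨unitInterval.pos_iff_ne_zero.2 ?_, unitInterval.lt_one_iff_ne_one.2 ?_⟩, rfl⟩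
    · rintro rfl
      exact hx ⟨_, (Γ.edgePoint_zero e).symm⟩
    · rintro rfl
      exact hx ⟨_, (Γ.edgePoint_one e).symm⟩

variable {Γ}

theorem isOpen_realization_iff {s : Set Γ.Realization} :
    IsOpen s ↔ ∀ e, IsOpen (Γ.edgePoint e ⁻¹' s) := by
  refine ⟨fun h e => h.preimage (Γ.continuous_edgePoint e), fun h => ?_⟩
  refine isQuotientMap_quot_mk.isOpen_preimage.1 (isOpen_sum_iff.2 ⟨isOpen_discrete _, ?_⟩)
  exact continuous_Prop.1 (continuous_prod_of_discrete_left.2 fun e => continuous_Prop.2 (h e))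

theorem isClosed_realization_iff {s : Set Γ.Realization} :
    IsClosed s ↔ ∀ e, IsClosed (Γ.edgePoint e ⁻¹' s) := by
  simp_rw [← isOpen_compl_iff, isOpen_realization_iff, preimage_compl]

variable (Γ)

theorem isOpen_openEdge (e : Γ.E) : IsOpen (Γ.openEdge e) := by
  refine isOpen_realization_iff.2 fun a => ?_
  have : Γ.edgePoint a ⁻¹' Γ.openEdge e = {t | (a = e ∨ a = Γ.bar e) ∧ t ∈ Ioo 0 1} := by
    ext t
    exact Γ.edgePoint_mem_openEdge_iff
  rw [this]
  exact isOpen_const.and isOpen_Ioo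

theorem isClosed_range_edgePoint (e : Γ.E) : IsClosed (range (Γ.edgePoint e)) := by
  refine isClosed_realization_iff.2 fun a => ?_
  by_cases h : a = e ∨ a = Γ.bar e
  · convert isClosed_univ
    refine eq_univ_of_forall fun t => ?_
    rcases h with rfl | rfl
    exacts [⟨t, rfl⟩, ⟨σ t, (Γ.edgePoint_bar' e t).symm⟩]
  · refine (Set.Finite.subset (s := {0, 1}) (by simp) ?_).isClosed
    rintro t ⟨s, hs⟩
    by_contra ht
    simp only [mem_insert_iff, mem_singleton_iff, not_or] at ht
    have hmem : Γ.edgePoint a t ∈ Γ.openEdge a := mem_image_of_mem _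
      ⟨unitInterval.pos_iff_ne_zero.2 ht.1, unitInterval.lt_one_iff_ne_one.2 ht.2⟩
    rw [← hs, edgePoint_mem_openEdge_iff] at hmem
    exact h (hmem.1.imp Eq.symm fun h => (Γ.bar_eq_iff.1 h.symm))

theorem vertexPoint_mem_closure_openEdge_iff {v : Γ.V} {e : Γ.E} :
    Γ.vertexPoint v ∈ closure (Γ.openEdge e) ↔ v = Γ.ι e ∨ v = Γ.ι (Γ.bar e) := by
  constructor
  · intro h
    obtain ⟨t, ht⟩ := closure_minimal (image_subset_range _ _) (Γ.isClosed_range_edgePoint e) h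
    by_cases h0 : t = 0
    · subst h0
      rw [edgePoint_zero] at ht
      exact Or.inl (Γ.vertexPoint_injective ht.symm)
    by_cases h1 : t = 1
    · subst h1
      rw [edgePoint_one] at ht
      exact Or.inr (Γ.vertexPoint_injective ht.symm)
    exact (Γ.edgePoint_ne_vertexPoint e h0 h1 v ht).elim
  · have key (a : Γ.E) : Γ.vertexPoint (Γ.ι a) ∈ closure (Γ.openEdge a) := by
      rw [← edgePoint_zero]
      refine image_closure_subset_closure_image (Γ.continuous_edgePoint a) ⟨0, ?_, rfl⟩
      rw [closure_Ioo zero_ne_one]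
      exact left_mem_Icc.2 zero_le_one
    rintro (rfl | rfl)
    · exact key e
    · rw [← openEdge_bar]
      exact key _

end OpenEdge

/-! ### Homeomorphisms preserving vertices -/

theorem homeomorph_symm_image_image {X Y : Type*} [TopologicalSpace X] [TopologicalSpace Y]
    (H : X ≃ₜ Y) (s : Set X) : H.symm '' (H '' s) = s :=
  H.toEquiv.symm_image_image s

theorem homeomorph_image_symm_image {X Y : Type*} [TopologicalSpace X] [TopologicalSpace Y]
    (H : X ≃ₜ Y) (s : Set Y) : H '' (H.symm '' s) = s :=
  H.toEquiv.image_symm_image s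

section VertexPreserving

variable {Γ Γ' : SerreGraph} (H : Γ.Realization ≃ₜ Γ'.Realization)

theorem exists_image_openEdge_subset (hH : H '' range Γ.vertexPoint = range Γ'.vertexPoint)
    (e : Γ.E) : ∃ e', H '' Γ.openEdge e ⊆ Γ'.openEdge e' := by
  have hv : ∀ x ∈ H '' Γ.openEdge e, x ∉ range Γ'.vertexPoint := by
    rintro _ ⟨x, hx, rfl⟩ h
    rw [← hH, H.injective.mem_set_image] at h
    obtain ⟨v, rfl⟩ := h
    exact Γ.vertexPoint_notMem_openEdge v e hx
  obtain ⟨x, hx⟩ := (Γ.openEdge_nonempty e).image H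
  obtain ⟨e', he'⟩ := Γ'.exists_mem_openEdge (hv x hx)
  refine ⟨e', ((Γ.isPreconnected_openEdge e).image H H.continuous.continuousOn
    ).subset_left_of_subset_union (Γ'.isOpen_openEdge e')
    (isOpen_iUnion fun a : {a // ¬ (a = e' ∨ a = Γ'.bar e')} => Γ'.isOpen_openEdge a.1)
    ?_ ?_ ⟨x, hx, he'⟩⟩
  · refine disjoint_left.2 fun y hy hy' => ?_
    obtain ⟨a, ha⟩ := mem_iUnion.1 hy'
    exact a.2 (Γ'.openEdge_eq_of_mem ha hy)
  · intro y hy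
    obtain ⟨a, ha⟩ := Γ'.exists_mem_openEdge (hv y hy)
    by_cases h : a = e' ∨ a = Γ'.bar e'
    · left
      rcases h with rfl | rfl
      exacts [ha, Γ'.openEdge_bar e' ▸ ha]
    · exact Or.inr (mem_iUnion.2 ⟨⟨a, h⟩, ha⟩)

theorem exists_image_openEdge_eq (hH : H '' range Γ.vertexPoint = range Γ'.vertexPoint)
    (e : Γ.E) : ∃ e', H '' Γ.openEdge e = Γ'.openEdge e' := by
  obtain ⟨e', he'⟩ := exists_image_openEdge_subset H hH e
  have hH' : H.symm '' range Γ'.vertexPoint = range Γ.vertexPoint := by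
    rw [← hH, homeomorph_symm_image_image H]
  obtain ⟨a, ha⟩ := exists_image_openEdge_subset H.symm hH' e'
  have hea : Γ.openEdge e ⊆ Γ.openEdge a := by
    refine Subset.trans ?_ ((image_mono he').trans ha)
    rw [homeomorph_symm_image_image H]
  obtain ⟨x, hx⟩ := Γ.openEdge_nonempty e
  have : Γ.openEdge a = Γ.openEdge e := by
    rcases Γ.openEdge_eq_of_mem (hea hx) hx with rfl | rfl
    exacts [rfl, Γ.openEdge_bar e]
  refine ⟨e', he'.antisymm ?_⟩
  rw [← this, ← homeomorph_image_symm_image H (Γ'.openEdge e')]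
  exact image_mono ha

/-- Graphs whose realizations are homeomorphic by a map matching the vertices are isomorphic. -/
theorem nonempty_iso_of_homeomorph (hH : H '' range Γ.vertexPoint = range Γ'.vertexPoint) :
    Nonempty (Iso Γ Γ') := by
  have hv (v : Γ.V) : ∃ w, Γ'.vertexPoint w = H (Γ.vertexPoint v) := by
    rw [← mem_range, ← hH]
    exact mem_image_of_mem _ ⟨v, rfl⟩
  choose f hf using hv
  have hf_bij : Function.Bijective f := by
    refine ⟨fun v w h => Γ.vertexPoint_injective (H.injective ?_), fun w => ?_⟩
    · rw [← hf, ← hf, h]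
    · obtain ⟨_, ⟨v, rfl⟩, h⟩ := hH ▸ mem_range_self (f := Γ'.vertexPoint) w
      exact ⟨v, Γ'.vertexPoint_injective ((hf v).trans h)⟩
  have hclosure {e : Γ.E} {e' : Γ'.E} (h : H '' Γ.openEdge e = Γ'.openEdge e') (v : Γ.V) :
      (f v = Γ'.ι e' ∨ f v = Γ'.ι (Γ'.bar e')) ↔ v = Γ.ι e ∨ v = Γ.ι (Γ.bar e) := by
    rw [← vertexPoint_mem_closure_openEdge_iff, ← vertexPoint_mem_closure_openEdge_iff, hf, ← h,
      ← H.image_closure, H.injective.mem_set_image]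
  have hedge (e : Γ.E) : ∃ e', H '' Γ.openEdge e = Γ'.openEdge e' ∧ Γ'.ι e' = f (Γ.ι e) ∧
      Γ'.ι (Γ'.bar e') = f (Γ.ι (Γ.bar e)) := by
    obtain ⟨e', he'⟩ := exists_image_openEdge_eq H hH e
    have h0 := (hclosure he' _).2 (Or.inl rfl)
    have h1 := (hclosure he' _).2 (Or.inr rfl)
    obtain ⟨v, hv⟩ := hf_bij.2 (Γ'.ι e')
    obtain ⟨w, hw⟩ := hf_bij.2 (Γ'.ι (Γ'.bar e'))
    have h2 := (hclosure he' v).1 (Or.inl hv)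
    have h3 := (hclosure he' w).1 (Or.inr hw)
    by_cases h : Γ'.ι e' = f (Γ.ι e)
    · refine ⟨e', he', h, ?_⟩
      grind
    · refine ⟨Γ'.bar e', he'.trans (Γ'.openEdge_bar e').symm, ?_, ?_⟩
      · grind
      · rw [Γ'.bar_bar]
        grind
  choose g hg hg₀ hg₁ using hedge
  obtain ⟨_⟩ : Nonempty (LinearOrder Γ.E) := ⟨WellOrderingRel.isWellOrder.linearOrder⟩
  let k (e : Γ.E) : Γ'.E := if e < Γ.bar e then g e else Γ'.bar (g (Γ.bar e))
  have hk_bar (e : Γ.E) : k (Γ.bar e) = Γ'.bar (k e) := by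
    rcases lt_or_gt_of_ne (Γ.bar_ne e) with h | h
    · simp [k, h, h.not_gt, Γ.bar_bar, Γ'.bar_bar]
    · simp [k, h, h.not_gt, Γ.bar_bar]
  have hk (e : Γ.E) : H '' Γ.openEdge e = Γ'.openEdge (k e) := by
    by_cases h : e < Γ.bar e
    · simp only [k, if_pos h, hg]
    · simp only [k, if_neg h, openEdge_bar, ← hg]
  have hk_ι (e : Γ.E) : f (Γ.ι e) = Γ'.ι (k e) := by
    by_cases h : e < Γ.bar e
    · simp only [k, if_pos h, hg₀]
    · simp only [k, if_neg h, hg₁, Γ.bar_bar]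
  have hk_bij : Function.Bijective k := by
    refine ⟨fun e a h => ?_, fun e' => ?_⟩
    · obtain ⟨x, hx⟩ := Γ.openEdge_nonempty e
      have hx' : x ∈ Γ.openEdge a := by
        rw [← H.injective.mem_set_image, hk a, ← h, ← hk e]
        exact mem_image_of_mem _ hx
      rcases Γ.openEdge_eq_of_mem hx hx' with rfl | rfl
      · rfl
      · rw [hk_bar] at h
        exact (Γ'.bar_ne _ h).elim
    · obtain ⟨e, he⟩ := exists_image_openEdge_eq H.symm
        (by rw [← hH, homeomorph_symm_image_image H]) e'
      obtain ⟨x, hx⟩ := Γ'.openEdge_nonempty e'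
      have hx' : x ∈ Γ'.openEdge (k e) := by
        rw [← hk, ← he, homeomorph_image_symm_image H]
        exact hx
      rcases Γ'.openEdge_eq_of_mem hx hx' with h | h
      exacts [⟨e, h.symm⟩, ⟨Γ.bar e, by rw [hk_bar, h]⟩]
  exact ⟨⟨Equiv.ofBijective f hf_bij, Equiv.ofBijective k hk_bij, hk_bar, hk_ι⟩⟩

end VertexPreserving

/-! ### Subdividing at finitely many points -/

open Relation in
/-- Finitely many points of the realization, including all vertices, are the vertices of an
iterated subdivision. -/
theorem exists_subdivision {Γ : SerreGraph} {P : Set Γ.Realization} (hP : P.Finite)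
    (hv : range Γ.vertexPoint ⊆ P) :
    ∃ (Δ : SerreGraph) (φ : Γ.Realization ≃ₜ Δ.Realization),
      ReflTransGen SubdivideStep Γ Δ ∧ φ '' P = range Δ.vertexPoint := by
  induction hn : (P \ range Γ.vertexPoint).ncard using Nat.strong_induction_on generalizing Γ with
  | _ n ih =>
  by_cases hsub : P ⊆ range Γ.vertexPoint
  · exact ⟨Γ, Homeomorph.refl _, .refl, by simpa using hsub.antisymm hv⟩
  obtain ⟨p, hp, hpv⟩ := not_subset.1 hsub
  obtain ⟨e, t, ht, rfl⟩ := Γ.exists_mem_openEdge hpv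
  let ψ := Γ.subdivideHomeomorph e ht.1.ne' ht.2.ne
  have hψ : range (Γ.subdivide e).vertexPoint ⊆ ψ '' P := by
    rintro _ ⟨_ | v, rfl⟩
    · exact ⟨_, hp, Γ.subdivideHomeomorph_edgePoint e ht.1.ne' ht.2.ne⟩
    · exact ⟨_, hv ⟨v, rfl⟩, Γ.subdivideHomeomorph_vertexPoint e ht.1.ne' ht.2.ne v⟩
  have hlt : (ψ '' P \ range (Γ.subdivide e).vertexPoint).ncard < n := by
    rw [← hn, ← ncard_image_of_injective (P \ _) ψ.injective]
    refine ncard_lt_ncard ⟨?_, fun h => ?_⟩ ((hP.sdiff).image _)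
    · rintro _ ⟨⟨x, hx, rfl⟩, h⟩
      refine mem_image_of_mem _ ⟨hx, ?_⟩
      rintro ⟨v, rfl⟩
      exact h ⟨some v, rfl⟩
    · exact (h (mem_image_of_mem ψ ⟨hp, hpv⟩)).2
        ⟨none, (Γ.subdivideHomeomorph_edgePoint e ht.1.ne' ht.2.ne).symm⟩
  obtain ⟨Δ, φ, hΔ, hφ⟩ := ih _ hlt (hP.image ψ) hψ rfl
  refine ⟨Δ, ψ.trans φ, .head ⟨e, ⟨Iso.refl _⟩⟩ hΔ, ?_⟩
  rw [← hφ, image_image]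
  rfl

open Relation in
/-- Finite graphs with homeomorphic realizations have isomorphic subdivisions. -/
theorem exists_iso_subdivisions {Γ Γ' : SerreGraph} [Finite Γ.V] [Finite Γ'.V]
    (H : Γ.Realization ≃ₜ Γ'.Realization) :
    ∃ Δ Δ', ReflTransGen SubdivideStep Γ Δ ∧ ReflTransGen SubdivideStep Γ' Δ' ∧
      Nonempty (Iso Δ Δ') := by
  let P := range Γ.vertexPoint ∪ H.symm '' range Γ'.vertexPoint
  have hP : P.Finite := (finite_range _).union ((finite_range _).image _)
  obtain ⟨Δ, φ, hΔ, hφ⟩ := exists_subdivision hP subset_union_left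
  obtain ⟨Δ', φ', hΔ', hφ'⟩ := exists_subdivision (Γ := Γ') (hP.image H) (by
    rw [image_union, homeomorph_image_symm_image H]
    exact subset_union_right)
  refine ⟨Δ, Δ', hΔ, hΔ', nonempty_iso_of_homeomorph ((φ.symm.trans H).trans φ') ?_⟩
  rw [← hφ, ← hφ', image_image, image_image]
  simp

/-! ### Removing leaves -/

section Leaf

variable {Γ : SerreGraph}

theorem IsWalk.concat {u : Γ.V} {l : List Γ.E} {e : Γ.E} (h : Γ.IsWalk l u (Γ.ι e)) :
    Γ.IsWalk (l ++ [e]) u (Γ.ι (Γ.bar e)) := by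
  induction l generalizing u with
  | nil => exact ⟨Eq.symm h, rfl⟩
  | cons a l ih => exact ⟨h.1, ih h.2⟩

theorem connected_iff : Γ.Connected ↔ ∀ p : Γ.V → Prop,
    (∀ e, p (Γ.ι e) → p (Γ.ι (Γ.bar e))) → ∀ u v, p u → p v := by
  constructor
  · intro h p hp u v hu
    obtain ⟨l, hl⟩ := h u v
    induction l generalizing u with
    | nil => exact (show u = v from hl) ▸ hu
    | cons a l ih =>
      obtain ⟨rfl, hl⟩ := hl
      exact ih _ (hp a hu) hl
  · intro h u v
    exact h (fun w => ∃ l, Γ.IsWalk l u w) (fun e ⟨l, hl⟩ => ⟨_, hl.concat⟩) u v ⟨[], rfl⟩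

theorem Connected.of_iso {Δ : SerreGraph} (h : Γ.Connected) (f : Iso Δ Γ) : Δ.Connected := by
  rw [connected_iff] at h ⊢
  intro p hp u v hu
  have := h (fun w => p (f.vEquiv.symm w)) (fun e he => by
    obtain ⟨e, rfl⟩ := f.eEquiv.surjective e
    rw [← f.map_ι, f.vEquiv.symm_apply_apply] at he
    rw [← f.map_bar, ← f.map_ι, f.vEquiv.symm_apply_apply]
    exact hp e he) (f.vEquiv u) (f.vEquiv v)
  simpa [hu] using this

theorem Connected.of_expand {u : Γ.V} (h : (Γ.expand u).Connected) : Γ.Connected := by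
  rw [connected_iff] at h ⊢
  intro p hp v w
  refine h (fun x => p (x.getD u)) ?_ (some v) (some w)
  rintro (e | _ | _)
  exacts [hp e, id, id]

/-- A graph is leafless if no vertex has degree one. -/
def Leafless (Γ : SerreGraph) : Prop := ∀ a, ∃ b, b ≠ a ∧ Γ.ι b = Γ.ι a

/-- The graph obtained by deleting the vertex of degree one at the origin of an edge. -/
def removeLeaf (Γ : SerreGraph) (a : Γ.E) (ha : ∀ b, Γ.ι b = Γ.ι a → b = a) : SerreGraph where
  V := {v : Γ.V // v ≠ Γ.ι a}
  E := {e : Γ.E // e ≠ a ∧ e ≠ Γ.bar a}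
  bar e := ⟨Γ.bar e.1, fun h => e.2.2 (Γ.bar_eq_iff.1 h), fun h => e.2.1 (Γ.bar_injective h)⟩
  bar_ne e h := Γ.bar_ne e.1 (congrArg Subtype.val h)
  bar_bar e := Subtype.ext (Γ.bar_bar e.1)
  ι e := ⟨Γ.ι e.1, fun h => e.2.1 (ha _ h)⟩

theorem exists_iso_expand_removeLeaf (a : Γ.E) (ha : ∀ b, Γ.ι b = Γ.ι a → b = a) :
    ∃ u, Nonempty (Iso ((Γ.removeLeaf a ha).expand u) Γ) := by
  classical
  let k : {e : Γ.E // e ≠ a ∧ e ≠ Γ.bar a} ⊕ Bool → Γ.E :=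
    Sum.elim Subtype.val fun b => if b then Γ.bar a else a
  have hk : Function.Bijective k := by
    constructor
    · rintro (e | _ | _) (e' | _ | _) h
      · exact congrArg Sum.inl (Subtype.ext h)
      · exact (e.2.1 h).elim
      · exact (e.2.2 h).elim
      · exact (e'.2.1 h.symm).elim
      · rfl
      · exact (Γ.bar_ne a h.symm).elim
      · exact (e'.2.2 h.symm).elim
      · exact (Γ.bar_ne a h).elim
      · rfl
    · intro e
      by_cases h0 : e = a
      · exact ⟨Sum.inr false, h0.symm⟩
      by_cases h1 : e = Γ.bar a
      · exact ⟨Sum.inr true, h1.symm⟩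
      exact ⟨Sum.inl ⟨e, h0, h1⟩, rfl⟩
  refine ⟨⟨Γ.ι (Γ.bar a), fun h => Γ.bar_ne a (ha _ h)⟩,
    ⟨⟨Equiv.optionSubtypeNe (Γ.ι a), Equiv.ofBijective k hk, ?_, ?_⟩⟩⟩
  · rintro (e | _ | _)
    exacts [rfl, rfl, (Γ.bar_bar a).symm]
  · rintro (e | _ | _) <;> rfl

open Relation in
/-- Every finite connected graph arises by expansions from a leafless one. -/
theorem exists_leafless [Finite Γ.V] [Nonempty Γ.V] (hΓ : Γ.Connected) :
    ∃ Γ₀ : SerreGraph, Finite Γ₀.V ∧ Nonempty Γ₀.V ∧ Γ₀.Connected ∧ Γ₀.Leafless ∧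
      ReflTransGen ExpandStep Γ₀ Γ := by
  rename_i hfin hne
  induction hn : Nat.card Γ.V using Nat.strong_induction_on generalizing Γ with
  | _ n ih =>
  by_cases hl : Γ.Leafless
  · exact ⟨Γ, hfin, hne, hΓ, hl, .refl⟩
  simp only [Leafless, not_forall, not_exists, not_and] at hl
  obtain ⟨a, ha⟩ := hl
  replace ha : ∀ b, Γ.ι b = Γ.ι a → b = a := fun b h => by_contra fun hb => ha b hb h
  obtain ⟨u, ⟨f⟩⟩ := Γ.exists_iso_expand_removeLeaf a ha
  have : Finite (Γ.removeLeaf a ha).V := Subtype.finite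
  have : Nonempty (Γ.removeLeaf a ha).V := ⟨u⟩
  have hlt : Nat.card (Γ.removeLeaf a ha).V < n := by
    rw [← hn, ← Nat.card_congr f.vEquiv]
    exact (Nat.lt_succ_self _).trans_eq Finite.card_option.symm
  obtain ⟨Γ₀, h1, h2, h3, h4, h5⟩ := ih _ hlt (hΓ.of_iso f).of_expand rfl
  exact ⟨Γ₀, h1, h2, h3, h4, h5.tail (Or.inl ⟨u, ⟨f⟩⟩)⟩

theorem Leafless.coreRealization_eq_empty_or_univ (hl : Γ.Leafless) (hΓ : Γ.Connected) :
    IsEmpty Γ.E ∧ Γ.coreRealization = ∅ ∨ Γ.coreRealization = univ := by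
  rcases isEmpty_or_nonempty Γ.E with h | ⟨⟨a⟩⟩
  · exact Or.inl ⟨h, eq_empty_of_forall_notMem fun _ ⟨e, _⟩ => h.elim e⟩
  · right
    have hcore (e : Γ.E) : e ∈ Γ.coreEdges :=
      ⟨univ, mem_univ _, fun _ _ => mem_univ _, fun a _ => by simpa using hl a⟩
    refine eq_univ_of_forall (realization_cases Γ (fun v => ?_) fun e t =>
      edgePoint_mem_coreRealization (hcore e) t)
    obtain ⟨e, rfl⟩ := connected_iff.1 hΓ (fun v => ∃ e, Γ.ι e = v) (fun e _ => ⟨_, rfl⟩)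
      (Γ.ι a) v ⟨a, rfl⟩
    rw [← edgePoint_zero]
    exact edgePoint_mem_coreRealization (hcore e) 0

theorem Connected.nonempty_iso_of_isEmpty {Γ' : SerreGraph} [Nonempty Γ.V] [Nonempty Γ'.V]
    [IsEmpty Γ.E] [IsEmpty Γ'.E] (hΓ : Γ.Connected) (hΓ' : Γ'.Connected) :
    Nonempty (Iso Γ Γ') := by
  have : Subsingleton Γ.V := ⟨fun u v =>
    connected_iff.1 hΓ (fun w => u = w) (fun e => isEmptyElim e) u v rfl⟩
  have : Subsingleton Γ'.V := ⟨fun u v =>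
    connected_iff.1 hΓ' (fun w => u = w) (fun e => isEmptyElim e) u v rfl⟩
  have := uniqueOfSubsingleton (Classical.arbitrary Γ.V)
  have := uniqueOfSubsingleton (Classical.arbitrary Γ'.V)
  exact ⟨⟨Equiv.ofUnique _ _, Equiv.equivOfIsEmpty _ _, fun e => isEmptyElim e,
    fun e => isEmptyElim e⟩⟩

open Relation in
/-- Leafless connected graphs with homeomorphic cores have isomorphic subdivisions. -/
theorem Leafless.exists_iso_subdivisions {Γ' : SerreGraph} [Finite Γ.V] [Finite Γ'.V]
    [Nonempty Γ.V] [Nonempty Γ'.V] (hl : Γ.Leafless) (hl' : Γ'.Leafless) (hΓ : Γ.Connected)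
    (hΓ' : Γ'.Connected) (H : Γ.coreRealization ≃ₜ Γ'.coreRealization) :
    ∃ Δ Δ', ReflTransGen SubdivideStep Γ Δ ∧ ReflTransGen SubdivideStep Γ' Δ' ∧
      Nonempty (Iso Δ Δ') := by
  have hne (Λ : SerreGraph) [Nonempty Λ.V] : Nonempty Λ.Realization :=
    ⟨Λ.vertexPoint (Classical.arbitrary _)⟩
  rcases hl.coreRealization_eq_empty_or_univ hΓ with ⟨hE, h⟩ | h <;>
    rcases hl'.coreRealization_eq_empty_or_univ hΓ' with ⟨hE', h'⟩ | h' <;> rw [h, h'] at H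
  · exact ⟨Γ, Γ', .refl, .refl, hΓ.nonempty_iso_of_isEmpty hΓ'⟩
  · exact (H.symm ⟨Classical.choice (hne Γ'), mem_univ _⟩).2.elim
  · exact (H ⟨Classical.choice (hne Γ), mem_univ _⟩).2.elim
  · exact SerreGraph.exists_iso_subdivisions
      (((Homeomorph.Set.univ _).symm.trans H).trans (Homeomorph.Set.univ _))

end Leaf

end SerreGraph

/-- Two finite connected graphs `Γ` and `Γ'` are equivalent (i.e. the
topological realizations `|C(Γ)|` and `|C(Γ')|` of their cores are homeomorphic) if and
only if there are finite sequences of elementary modifications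
`Γ = Γ₀ → Γ₁ → … → Γₙ` and `Γ' = Γ'₀ → Γ'₁ → … → Γ'ₘ` such that `Γₙ` and `Γ'ₘ` are
isomorphic. -/
theorem statement_17 (Γ Γ' : SerreGraph)
    (hV : Finite Γ.V) (hE : Finite Γ.E) (hne : Nonempty Γ.V) (hconn : Γ.Connected)
    (hV' : Finite Γ'.V) (hE' : Finite Γ'.E) (hne' : Nonempty Γ'.V)
    (hconn' : Γ'.Connected) :
    Nonempty (↥Γ.coreRealization ≃ₜ ↥Γ'.coreRealization) ↔
      ∃ Δ Δ' : SerreGraph, Relation.ReflTransGen SerreGraph.ElemMod Γ Δ ∧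
        Relation.ReflTransGen SerreGraph.ElemMod Γ' Δ' ∧ Nonempty (SerreGraph.Iso Δ Δ') := by
  constructor
  · rintro ⟨H⟩
    obtain ⟨Γ₀, _, _, hconn₀, hl, h₀⟩ := SerreGraph.exists_leafless hconn
    obtain ⟨Γ₀', _, _, hconn₀', hl', h₀'⟩ := SerreGraph.exists_leafless hconn'
    have hE := Relation.ReflTransGen.mono SerreGraph.expandStep_le_elemMod
    obtain ⟨f⟩ := SerreGraph.nonempty_coreRealization_homeomorph_of_reflTransGen (hE _ _ h₀)
    obtain ⟨f'⟩ := SerreGraph.nonempty_coreRealization_homeomorph_of_reflTransGen (hE _ _ h₀')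
    obtain ⟨Δ, Δ', hΔ, hΔ', ⟨g⟩⟩ :=
      hl.exists_iso_subdivisions hl' hconn₀ hconn₀' ((f.trans H).trans f'.symm)
    obtain ⟨Λ, hΛ, hΛ'⟩ := SerreGraph.exists_common_modification h₀ h₀' hΔ hΔ' g
    exact ⟨Λ, Λ, hΛ, hΛ', ⟨SerreGraph.Iso.refl Λ⟩⟩
  · rintro ⟨Δ, Δ', h, h', ⟨g⟩⟩
    obtain ⟨f⟩ := SerreGraph.nonempty_coreRealization_homeomorph_of_reflTransGen h
    obtain ⟨f'⟩ := SerreGraph.nonempty_coreRealization_homeomorph_of_reflTransGen h'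
    obtain ⟨k⟩ := g.nonempty_coreRealization_homeomorph
    exact ⟨(f.trans k).trans f'.symm⟩
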